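/- Let K be the dual complex of a simple 3-polytope. The product H̃⁰(K_{{i,j}}) ⊗ H̃⁰(K_{{k,l}}) → H̃¹(K_{{i,j,k,l}}) (induced by the inclusion K_{{i,j,k,l}} → K_{{i,j}} * K_{{k,l}} for disjoint pairs) is nontrivial for some choice of disjoint missing edges {i,j}, {k,l} if and only if K contains a chordless 4-cycle, i.e., the polytope has a 4-belt. -/

import Mathlib

/-- A combinatorial model of a simple 3-polytope: `m` facets, each given by
its (finite) set of vertices; every vertex lies in exactly three facets, two
distinct facets meet in an edge (two vertices) or not at all. -/
structure SimplePolytope3 (m : ℕ) (V : Type) [Fintype V] [DecidableEq V] where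
  facet : Fin m → Finset V
  facet_card : ∀ i, 3 ≤ (facet i).card
  vertex_in_three : ∀ v : V, (Finset.univ.filter (fun i => v ∈ facet i)).card = 3
  inter_edge : ∀ i j, i ≠ j → facet i ∩ facet j = ∅ ∨ (facet i ∩ facet j).card = 2
  four_le_m : 4 ≤ m

namespace SimplePolytope3

variable {m : ℕ} {V : Type} [Fintype V] [DecidableEq V] (P : SimplePolytope3 m V)

/-- Two facets are adjacent if they are distinct and intersect. -/
def Adjacent (i j : Fin m) : Prop := i ≠ j ∧ (P.facet i ∩ P.facet j).Nonempty

/-- A `k`-belt: a cyclic sequence of `k ≥ 3` pairwise distinct facets such that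
consecutive facets (cyclically) are adjacent, non-consecutive ones are disjoint,
and no three of them share a common vertex. -/
def IsBelt (k : ℕ) (b : ZMod k → Fin m) : Prop :=
  3 ≤ k ∧ Function.Injective b ∧
  (∀ s t : ZMod k, s ≠ t →
    ((P.facet (b s) ∩ P.facet (b t)).Nonempty ↔ (t = s + 1 ∨ s = t + 1))) ∧
  (∀ s t u : ZMod k, s ≠ t → t ≠ u → s ≠ u →
    P.facet (b s) ∩ P.facet (b t) ∩ P.facet (b u) = ∅)

/-- A simple polytope is flag if every nonempty collection of pairwise
intersecting facets has a common vertex. -/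
def Flag : Prop :=
  ∀ S : Finset (Fin m), S.Nonempty →
    (∀ i ∈ S, ∀ j ∈ S, (P.facet i ∩ P.facet j).Nonempty) →
    ∃ v, ∀ i ∈ S, v ∈ P.facet i

/-- A Pogorelov polytope: a simple 3-polytope different from the simplex
(equivalently, with at least 5 facets) having no 3-belts and no 4-belts. -/
def Pogorelov : Prop :=
  5 ≤ m ∧ (¬ ∃ b : ZMod 3 → Fin m, P.IsBelt 3 b) ∧ (¬ ∃ b : ZMod 4 → Fin m, P.IsBelt 4 b)

end SimplePolytope3

namespace SimplePolytope3

variable {m : ℕ} {V : Type} [Fintype V] [DecidableEq V] (P : SimplePolytope3 m V)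

/-- Faces of the dual simplicial complex `K = K_P`: sets of facets with a
common vertex (together with the empty face). -/
def dFace (S : Finset (Fin m)) : Prop :=
  S = ∅ ∨ ∃ v : V, ∀ i ∈ S, v ∈ P.facet i

/-- The edges of the full subcomplex `K_I` of the dual complex on `I`. -/
def DEdge (I : Finset (Fin m)) : Type :=
  {e : Finset (Fin m) // e ⊆ I ∧ e.card = 2 ∧ P.dFace e}

/-- The smaller endpoint of an edge of `K_I`. -/
def emin {I : Finset (Fin m)} (e : P.DEdge I) : Fin m :=
  e.1.min' (Finset.card_pos.mp (by have h := e.2.2.1; omega))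

/-- The larger endpoint of an edge of `K_I`. -/
def emax {I : Finset (Fin m)} (e : P.DEdge I) : Fin m :=
  e.1.max' (Finset.card_pos.mp (by have h := e.2.2.1; omega))

/-- The simplicial coboundary `d : C⁰(K_I) → C¹(K_I)`. -/
def coboundary (I : Finset (Fin m)) : (Fin m → ℤ) →ₗ[ℤ] (P.DEdge I → ℤ) where
  toFun φ := fun e => φ (P.emax e) - φ (P.emin e)
  map_add' := by intro φ ψ; funext e; simp [Pi.add_apply]; ring
  map_smul' := by intro a φ; funext e; simp [Pi.smul_apply, smul_eq_mul]; ring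

/-- The reduced first simplicial cohomology `H̃¹(K_I)` of the full subcomplex
`K_I` (there are no 2-simplices in `K_I` when `I` is a union of two missing
edges, so every 1-cochain is a cocycle). -/
abbrev H1 (I : Finset (Fin m)) :=
  (P.DEdge I → ℤ) ⧸ LinearMap.range (P.coboundary I)

/-- The cohomology product of the canonical generators of `H̃⁰(K_A)` and
`H̃⁰(K_B)` for disjoint missing edges `A` and `B`, landing in `H̃¹(K_{A∪B})`:
it is induced by the simplicial inclusion `K_{A∪B} → K_A * K_B` and is
represented by the simplicial cup product of indicator 0-cochains, i.e. by the
indicator 1-cochain of the edge joining the chosen vertices of `A` and `B`. -/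
def cupClass (A B : Finset (Fin m)) (hA : A.Nonempty) (hB : B.Nonempty) :
    P.H1 (A ∪ B) :=
  Submodule.Quotient.mk
    (fun e : P.DEdge (A ∪ B) => if A.min' hA ∈ e.1 ∧ B.min' hB ∈ e.1 then 1 else 0)

end SimplePolytope3

namespace SimplePolytope3

variable {m : ℕ} {V : Type} [Fintype V] [DecidableEq V] {P : SimplePolytope3 m V}

lemma emin_lt_emax {I : Finset (Fin m)} (e : P.DEdge I) : P.emin e < P.emax e :=
  Finset.min'_lt_max'_of_card _ (by have h := e.2.2.1; omega)

lemma endpoints_of_eq_pair {I : Finset (Fin m)} {e : P.DEdge I} {x y : Fin m}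
    (he : e.1 = {x, y}) :
    (P.emin e = x ∧ P.emax e = y) ∨ (P.emin e = y ∧ P.emax e = x) := by
  have hmin : P.emin e ∈ e.1 := Finset.min'_mem _ _
  have hmax : P.emax e ∈ e.1 := Finset.max'_mem _ _
  have hlt := emin_lt_emax e
  rw [he, Finset.mem_insert, Finset.mem_singleton] at hmin hmax
  rcases hmin with h | h <;> rcases hmax with h' | h' <;> rw [h, h'] at hlt ⊢ <;>
    simp_all

lemma dEdge_eq_cross_pair {A B : Finset (Fin m)} (hA : A.card = 2) (hB : B.card = 2)
    (hfA : ¬ P.dFace A) (hfB : ¬ P.dFace B) (e : P.DEdge (A ∪ B)) :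
    ∃ a ∈ A, ∃ b ∈ B, e.1 = {a, b} ∧ P.dFace {a, b} := by
  obtain ⟨e, hsub, hcard, hface⟩ := e
  have not_subset : ∀ C : Finset (Fin m), C.card = 2 → ¬ P.dFace C → ¬ e ⊆ C := by
    intro C hC hfC h
    exact hfC (Finset.eq_of_subset_of_card_le h (by omega) ▸ hface)
  have hnA := not_subset A hA hfA
  have hnB := not_subset B hB hfB
  obtain ⟨x, y, -, rfl⟩ := Finset.card_eq_two.mp hcard
  simp only [Finset.insert_subset_iff, Finset.singleton_subset_iff, Finset.mem_union]
    at hsub hnA hnB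
  by_cases hx : x ∈ A
  · exact ⟨x, hx, y, by tauto, rfl, hface⟩
  · exact ⟨y, by tauto, x, by tauto, Finset.pair_comm x y, Finset.pair_comm x y ▸ hface⟩

/-- A set of vertices separating the two distinguished vertices, and crossed by no edge other
than the one joining them, exhibits the product cochain as a coboundary. -/
lemma cupClass_eq_zero_of_cut {A B : Finset (Fin m)} (hA : A.card = 2) (hB : B.card = 2)
    (hAB : Disjoint A B) (hfA : ¬ P.dFace A) (hfB : ¬ P.dFace B)
    (hA' : A.Nonempty) (hB' : B.Nonempty) (S : Finset (Fin m))
    (hcut : P.dFace {A.min' hA', B.min' hB'} → A.min' hA' ∈ S ∧ B.min' hB' ∉ S)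
    (hclosed : ∀ a ∈ A, ∀ b ∈ B, P.dFace {a, b} → ¬ (a = A.min' hA' ∧ b = B.min' hB') →
      (a ∈ S ↔ b ∈ S)) :
    P.cupClass A B hA' hB' = 0 := by
  have ha₀ := A.min'_mem hA'
  have hb₀ := B.min'_mem hB'
  unfold cupClass
  set a₀ := A.min' hA'
  set b₀ := B.min' hB'
  rw [Submodule.Quotient.mk_eq_zero, LinearMap.mem_range]
  refine ⟨fun x => if x ∈ S then (if a₀ < b₀ then -1 else 1) else 0, ?_⟩
  funext e
  obtain ⟨a, ha, b, hb, he, hf⟩ := dEdge_eq_cross_pair hA hB hfA hfB e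
  have hlt := emin_lt_emax e
  have hmem : (a₀ ∈ e.1 ∧ b₀ ∈ e.1) ↔ (a = a₀ ∧ b = b₀) := by
    have h₁ : a₀ ≠ b := fun h => Finset.disjoint_left.mp hAB ha₀ (h ▸ hb)
    have h₂ : b₀ ≠ a := fun h => Finset.disjoint_left.mp hAB ha (h ▸ hb₀)
    rw [he]
    simp [h₁, h₂, eq_comm]
  simp only [coboundary, LinearMap.coe_mk, AddHom.coe_mk, hmem]
  by_cases hab : a = a₀ ∧ b = b₀
  · obtain ⟨rfl, rfl⟩ := hab
    obtain ⟨haS, hbS⟩ := hcut hf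
    rcases endpoints_of_eq_pair he with ⟨h, h'⟩ | ⟨h, h'⟩ <;> rw [h, h'] at hlt ⊢
    · simp [haS, hbS, hlt]
    · simp [haS, hbS, hlt.not_gt]
  · have hS := hclosed a ha b hb hf hab
    rcases endpoints_of_eq_pair he with ⟨h, h'⟩ | ⟨h, h'⟩ <;> simp [h, h', hS, hab]

lemma cupClass_ne_zero_iff {A B : Finset (Fin m)} (hA : A.card = 2) (hB : B.card = 2)
    (hAB : Disjoint A B) (hfA : ¬ P.dFace A) (hfB : ¬ P.dFace B)
    (hA' : A.Nonempty) (hB' : B.Nonempty) :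
    P.cupClass A B hA' hB' ≠ 0 ↔ ∀ a ∈ A, ∀ b ∈ B, P.dFace {a, b} := by
  have ha₀ := A.min'_mem hA'
  have hb₀ := B.min'_mem hB'
  obtain ⟨a₁, ha₁⟩ := Finset.card_eq_one.mp
    (show (A.erase (A.min' hA')).card = 1 by rw [Finset.card_erase_of_mem ha₀, hA])
  obtain ⟨b₁, hb₁⟩ := Finset.card_eq_one.mp
    (show (B.erase (B.min' hB')).card = 1 by rw [Finset.card_erase_of_mem hb₀, hB])
  have hAm : ∀ x, x ∈ A ↔ x = A.min' hA' ∨ x = a₁ := fun x => by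
    have h := Finset.ext_iff.mp ha₁ x
    grind
  have hBm : ∀ x, x ∈ B ↔ x = B.min' hB' ∨ x = b₁ := fun x => by
    have h := Finset.ext_iff.mp hb₁ x
    grind
  have ha₁' := Finset.mem_erase.mp (ha₁ ▸ Finset.mem_singleton_self a₁)
  have hb₁' := Finset.mem_erase.mp (hb₁ ▸ Finset.mem_singleton_self b₁)
  have hne : ∀ a ∈ A, ∀ b ∈ B, a ≠ b := fun a ha b hb h =>
    Finset.disjoint_left.mp hAB ha (h ▸ hb)
  have h₀₀ := hne _ ha₀ _ hb₀
  have h₀₁ := hne _ ha₀ _ hb₁'.2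
  have h₁₀ := hne _ ha₁'.2 _ hb₀
  have h₁₁ := hne _ ha₁'.2 _ hb₁'.2
  constructor
  · intro hcup a ha b hb
    by_contra hf
    apply hcup
    rcases (hAm a).mp ha with rfl | rfl <;> rcases (hBm b).mp hb with rfl | rfl
    · refine cupClass_eq_zero_of_cut hA hB hAB hfA hfB hA' hB' ∅ (fun h => absurd h hf) ?_
      simp
    · refine cupClass_eq_zero_of_cut hA hB hAB hfA hfB hA' hB' {A.min' hA'} ?_ ?_
      · grind
      · grind
    · refine cupClass_eq_zero_of_cut hA hB hAB hfA hfB hA' hB' (A ∪ {b₁}) ?_ ?_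
      · grind
      · grind
    · refine cupClass_eq_zero_of_cut hA hB hAB hfA hfB hA' hB' {A.min' hA', b} ?_ ?_
      · grind
      · grind
  · intro hall hcup
    unfold cupClass at hcup
    rw [Submodule.Quotient.mk_eq_zero, LinearMap.mem_range] at hcup
    obtain ⟨φ, hφ⟩ := hcup
    have value : ∀ a ∈ A, ∀ b ∈ B, (φ a = φ b ↔ ¬ (a = A.min' hA' ∧ b = B.min' hB')) := by
      intro a ha b hb
      have hsub : ({a, b} : Finset (Fin m)) ⊆ A ∪ B := by
        simp [Finset.insert_subset_iff, ha, hb]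
      let e : P.DEdge (A ∪ B) := ⟨{a, b}, hsub, Finset.card_pair (hne a ha b hb), hall a ha b hb⟩
      have hmem : (A.min' hA' ∈ e.1 ∧ B.min' hB' ∈ e.1) ↔
          (a = A.min' hA' ∧ b = B.min' hB') := by
        simp [e, hne _ ha₀ _ hb, (hne _ ha _ hb₀).symm, eq_comm]
      have hval := congrFun hφ e
      simp only [coboundary, LinearMap.coe_mk, AddHom.coe_mk, hmem] at hval
      rcases endpoints_of_eq_pair (e := e) rfl with ⟨h, h'⟩ | ⟨h, h'⟩ <;> rw [h, h'] at hval <;>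
        split_ifs at hval with hc <;> simp only [hc, not_false_eq_true] <;>
        grind
    have e₀₀ := value _ ha₀ _ hb₀
    have e₀₁ := (value _ ha₀ _ hb₁'.2).mpr (fun h => hb₁'.1 h.2)
    have e₁₀ := (value _ ha₁'.2 _ hb₀).mpr (fun h => ha₁'.1 h.1)
    have e₁₁ := (value _ ha₁'.2 _ hb₁'.2).mpr (fun h => ha₁'.1 h.1)
    exact e₀₀.mp (by rw [e₀₁, ← e₁₁, e₁₀]) ⟨rfl, rfl⟩

end SimplePolytope3

open SimplePolytope3 in
/-- Let `K` be the dual complex of a simple 3-polytope `P`. The product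
`H̃⁰(K_{i,j}) ⊗ H̃⁰(K_{k,l}) → H̃¹(K_{i,j,k,l})` is nontrivial for some choice
of disjoint missing edges `{i,j}`, `{k,l}` if and only if `K` contains a
chordless 4-cycle `i–k–j–l` (with `{i,j} ∉ K` and `{k,l} ∉ K`), i.e. the
polytope has a 4-belt. -/
theorem product_nontrivial_iff_chordless_four_cycle
    {m : ℕ} {V : Type} [Fintype V] [DecidableEq V]
    (P : SimplePolytope3 m V) :
    (∃ (A B : Finset (Fin m)) (h2A : A.card = 2) (h2B : B.card = 2),
      Disjoint A B ∧ ¬ P.dFace A ∧ ¬ P.dFace B ∧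
        P.cupClass A B (Finset.card_pos.mp (by omega))
          (Finset.card_pos.mp (by omega)) ≠ 0) ↔
    (∃ i j k l : Fin m,
      i ≠ j ∧ i ≠ k ∧ i ≠ l ∧ j ≠ k ∧ j ≠ l ∧ k ≠ l ∧
      P.dFace {i, k} ∧ P.dFace {k, j} ∧ P.dFace {j, l} ∧ P.dFace {l, i} ∧
      ¬ P.dFace {i, j} ∧ ¬ P.dFace {k, l}) := by
  constructor
  · rintro ⟨A, B, hA, hB, hAB, hfA, hfB, hcup⟩
    rw [cupClass_ne_zero_iff hA hB hAB hfA hfB] at hcup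
    obtain ⟨i, j, hij, rfl⟩ := Finset.card_eq_two.mp hA
    obtain ⟨k, l, hkl, rfl⟩ := Finset.card_eq_two.mp hB
    simp only [Finset.disjoint_insert_left, Finset.disjoint_singleton_left, Finset.mem_insert,
      Finset.mem_singleton, not_or] at hAB
    obtain ⟨⟨hik, hil⟩, hjk, hjl⟩ := hAB
    refine ⟨i, j, k, l, hij, hik, hil, hjk, hjl, hkl, hcup i (by simp) k (by simp), ?_,
      hcup j (by simp) l (by simp), ?_, hfA, hfB⟩
    · rw [Finset.pair_comm]; exact hcup j (by simp) k (by simp)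
    · rw [Finset.pair_comm]; exact hcup i (by simp) l (by simp)
  · rintro ⟨i, j, k, l, hij, hik, hil, hjk, hjl, hkl, fik, fkj, fjl, fli, hfA, hfB⟩
    have hAB : Disjoint ({i, j} : Finset (Fin m)) {k, l} := by
      simp [hik.symm, hil.symm, hjk.symm, hjl.symm]
    refine ⟨{i, j}, {k, l}, Finset.card_pair hij, Finset.card_pair hkl, hAB, hfA, hfB, ?_⟩
    rw [cupClass_ne_zero_iff (Finset.card_pair hij) (Finset.card_pair hkl) hAB hfA hfB]
    rw [Finset.pair_comm] at fkj fli
    simp [fik, fkj, fjl, fli]
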